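/- arXiv:1512.04160 — 2 statements merged into one kernel-verified Lean document; each statement's English description precedes it below -/
import Mathlib

section
/- Complete multipartite graphs are determined by their distance spectrum: if Ω is a connected graph whose distance matrix has the same spectrum as that of K_{a_1,...,a_s}, then Ω is isomorphic to K_{a_1,...,a_s}. -/
open SimpleGraph Matrix Finset

/-- The distance matrix of a graph, with real entries. -/
noncomputable def distMatrix {V : Type*} [Fintype V] (G : SimpleGraph V) : Matrix V V ℝ :=
  Matrix.of fun x y => (G.dist x y : ℝ)

lemma distMatrix_isHermitian {V : Type*} [Fintype V] (G : SimpleGraph V) :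
    (distMatrix G).IsHermitian := by
  ext x y
  simp [distMatrix, Matrix.conjTranspose_apply, SimpleGraph.dist_comm]

/-- The multiset of eigenvalues (with multiplicity) of the distance matrix of `G`. -/
noncomputable def distSpec {V : Type*} [Fintype V] [DecidableEq V] (G : SimpleGraph V) :
    Multiset ℝ :=
  Finset.univ.val.map (distMatrix_isHermitian G).eigenvalues

/-- The matrix with entry `2` inside the classes of `f` and `1` across. -/
noncomputable def pMat {V ι : Type*} [DecidableEq ι] (f : V → ι) : Matrix V V ℝ :=
  Matrix.of fun v w => 1 + if f v = f w then 1 else 0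

noncomputable def incMat {V ι : Type*} [DecidableEq ι] (f : V → ι) : Matrix V ι ℝ :=
  Matrix.of fun v i => if f v = i then 1 else 0

lemma pMat_eq {V ι : Type*} [Fintype V] [Fintype ι] [DecidableEq ι] (f : V → ι) :
    pMat f = incMat f * ((1 + (Matrix.of fun _ _ => (1:ℝ) : Matrix ι ι ℝ)) * Matrix.transpose (incMat f)) := by
  ext v w
  rw [Matrix.add_mul, Matrix.mul_add, Matrix.one_mul]
  simp [pMat, incMat, Matrix.mul_apply, eq_comm, add_comm]

lemma pMat_posSemidef {V ι : Type*} [Fintype V] [Fintype ι] [DecidableEq ι] (f : V → ι) :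
    (pMat f).PosSemidef := by
  have h1 : pMat f = incMat f * (incMat f)ᴴ + vecMulVec (fun _ => (1:ℝ)) (star fun _ => (1:ℝ)) := by
    ext v w
    simp [pMat, incMat, Matrix.mul_apply, vecMulVec, eq_comm, add_comm]
  rw [h1]
  exact (posSemidef_self_mul_conjTranspose _).add (posSemidef_vecMulVec_self_star _)

/-- size of a class -/
def fibCard {V ι : Type*} [Fintype V] [DecidableEq ι] (f : V → ι) (i : ι) : ℕ :=
  Fintype.card {v // f v = i}

lemma inc_mul {V ι : Type*} [Fintype V] [Fintype ι] [DecidableEq ι] (f : V → ι) :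
    (incMat f)ᵀ * incMat f = diagonal fun i => (fibCard f i : ℝ) := by
  ext i j
  rw [Matrix.mul_apply, diagonal_apply]
  split_ifs with h
  · subst h
    simp only [incMat, fibCard, Fintype.card_subtype, Matrix.transpose_apply, Matrix.of_apply]
    rw [Finset.card_filter]
    push_cast
    apply Finset.sum_congr rfl
    intro v _
    split_ifs <;> simp
  · apply Finset.sum_eq_zero
    intro v _
    simp only [incMat, Matrix.transpose_apply, Matrix.of_apply]
    grind

open Polynomial in
noncomputable def pPoly {ι : Type*} [Fintype ι] (a : ι → ℝ) : ℝ[X] := ∏ i, (X - C (a i))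

open Polynomial in
lemma small_charpoly {ι : Type*} [Fintype ι] [DecidableEq ι] (a : ι → ℝ) :
    ((1 + (Matrix.of fun _ _ => (1:ℝ) : Matrix ι ι ℝ)) * diagonal a).charpoly =
      ((Fintype.card ι : ℝ[X]) + 1) * pPoly a - X * derivative (pPoly a) := by
  apply Polynomial.eq_of_infinite_eval_eq
  apply Set.Infinite.mono (s := (Set.range a)ᶜ)
  swap
  · exact (Set.finite_range a).infinite_compl
  intro x hx
  have hx' : ∀ i, x - a i ≠ 0 := fun i h => hx ⟨i, by linarith⟩
  rw [Set.mem_ofPred_eq, Matrix.eval_charpoly]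
  have e : Matrix.scalar ι x - (1 + (Matrix.of fun _ _ => (1:ℝ) : Matrix ι ι ℝ)) * diagonal a =
      diagonal (fun i => x - a i) +
        replicateCol Unit (fun _ => (1:ℝ)) * replicateRow Unit (fun i => - a i) := by
    ext i j
    by_cases h : i = j
    · subst h; simp [Matrix.mul_diagonal, Matrix.mul_apply (M := replicateCol _ _)]; ring
    · simp [Matrix.mul_diagonal, Matrix.mul_apply (M := replicateCol _ _), h]
  have hdet : IsUnit (diagonal (fun i => x - a i)).det := by
    rw [det_diagonal, isUnit_iff_ne_zero]
    exact Finset.prod_ne_zero_iff.2 fun i _ => hx' i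
  have hinv : (diagonal (fun i => x - a i))⁻¹ = diagonal (fun i => (x - a i)⁻¹) := by
    apply Matrix.inv_eq_right_inv
    rw [diagonal_mul_diagonal]
    simp [hx']
  rw [e, det_add_replicateCol_mul_replicateRow hdet, hinv, det_diagonal]
  have hd : (derivative (pPoly a)).eval x = (∏ i, (x - a i)) * ∑ i, (x - a i)⁻¹ := by
    rw [pPoly, derivative_prod_finset, eval_finsetSum, Finset.mul_sum]
    apply Finset.sum_congr rfl
    intro i _
    rw [← Finset.prod_erase_mul _ _ (Finset.mem_univ i)]
    simp [eval_prod, hx']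
  have hs : ∑ i, a i * (x - a i)⁻¹ = x * (∑ i, (x - a i)⁻¹) - Fintype.card ι := by
    have : (Fintype.card ι : ℝ) = ∑ i : ι, (1:ℝ) := by simp
    rw [this, Finset.mul_sum, ← Finset.sum_sub_distrib]
    apply Finset.sum_congr rfl
    intro i _
    have := hx' i
    field_simp
    ring
  rw [Matrix.det_unique, Matrix.add_apply, Matrix.one_apply_eq, Matrix.mul_apply]
  have hm : ∑ j, (replicateRow Unit (fun i => - a i) * diagonal (fun i => (x - a i)⁻¹)) default j *
      replicateCol Unit (fun _ => (1:ℝ)) j default = - ∑ i, a i * (x - a i)⁻¹ := by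
    rw [← Finset.sum_neg_distrib]
    apply Finset.sum_congr rfl
    intro i _
    rw [Matrix.mul_diagonal]
    simp
  rw [hm, hs]
  have hp : (pPoly a).eval x = ∏ i, (x - a i) := by simp [pPoly, eval_prod]
  simp only [eval_sub, eval_mul, eval_add, eval_natCast, eval_one, eval_X, hd, hp]
  ring

open Polynomial in
noncomputable def rPoly {V ι : Type*} [Fintype V] [Fintype ι] [DecidableEq ι] (f : V → ι) : ℝ[X] :=
  X ^ (Fintype.card V - Fintype.card ι) * pPoly (fun i => (fibCard f i : ℝ))

open Polynomial in
lemma pMat_charpoly {V ι : Type*} [Fintype V] [DecidableEq V] [Fintype ι] [DecidableEq ι]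
    (f : V → ι) (hf : Function.Surjective f) :
    (pMat f).charpoly =
      ((Fintype.card V : ℝ[X]) + 1) * rPoly f - X * derivative (rPoly f) := by
  have hle := Fintype.card_le_of_surjective f hf
  rw [pMat_eq, charpoly_mul_comm_of_le _ _ hle, Matrix.mul_assoc, inc_mul, small_charpoly, rPoly]
  obtain ⟨k, hk⟩ := Nat.exists_eq_add_of_le hle
  rw [hk, Nat.add_sub_cancel_left, derivative_mul, derivative_X_pow]
  rcases k with _ | k
  · simp
  · push_cast
    simp only [Nat.add_sub_cancel, map_add, map_natCast, map_one, pow_succ]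
    ring

open Polynomial in
lemma rPoly_natDegree {V ι : Type*} [Fintype V] [Fintype ι] [DecidableEq ι]
    (f : V → ι) (hf : Function.Surjective f) :
    (rPoly f).natDegree = Fintype.card V := by
  have hle := Fintype.card_le_of_surjective f hf
  have hP : (pPoly fun i => (fibCard f i : ℝ)).Monic := monic_prod_X_sub_C _ _
  rw [rPoly, (monic_X_pow _).natDegree_mul hP, natDegree_X_pow, pPoly,
    natDegree_finsetProd_X_sub_C_eq_card, Finset.card_univ]
  omega

open Polynomial in
lemma recover (n : ℕ) (R S : ℝ[X]) (hR : R.natDegree ≤ n) (hS : S.natDegree ≤ n)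
    (h : ((n : ℝ[X]) + 1) * R - X * derivative R = ((n : ℝ[X]) + 1) * S - X * derivative S) :
    R = S := by
  have key : ∀ (T : ℝ[X]) (k : ℕ), (((n : ℝ[X]) + 1) * T - X * derivative T).coeff k =
      ((n : ℝ) + 1 - k) * T.coeff k := by
    intro T k
    have : ((n : ℝ[X]) + 1) = C ((n : ℝ) + 1) := by simp
    rw [this, coeff_sub, coeff_C_mul]
    rcases k with _ | k
    · simp
    · rw [coeff_X_mul, coeff_derivative]; push_cast; ring
  ext k
  by_cases hk : k ≤ n
  · have h1 := congrArg (fun p => p.coeff k) h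
    simp only [key] at h1
    have : ((n : ℝ) + 1 - k) ≠ 0 := by
      have : (k:ℝ) ≤ n := by exact_mod_cast hk
      linarith
    exact mul_left_cancel₀ this h1
  · rw [coeff_eq_zero_of_natDegree_lt (by omega), coeff_eq_zero_of_natDegree_lt (by omega)]

open Polynomial in
lemma rPoly_roots {V ι : Type*} [Fintype V] [Fintype ι] [DecidableEq ι]
    (f : V → ι) (k : ℕ) (hk : k ≠ 0) :
    (rPoly f).roots.count (k : ℝ) = Fintype.card {i // fibCard f i = k} := by
  have hP : (pPoly fun i => (fibCard f i : ℝ)).Monic := monic_prod_X_sub_C _ _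
  rw [rPoly, roots_mul ((monic_X_pow _).mul hP).ne_zero, pPoly, roots_X_pow]
  rw [roots_prod _ _ (Finset.prod_ne_zero_iff.2 fun i _ => X_sub_C_ne_zero _)]
  have hk' : (k : ℝ) ≠ 0 := by exact_mod_cast hk
  simp only [roots_X_sub_C, Multiset.bind_singleton, Multiset.count_add, Multiset.count_map]
  rw [Multiset.count_nsmul, Multiset.count_singleton, if_neg hk', mul_zero, zero_add,
    Fintype.card_subtype]
  simp only [Nat.cast_inj, eq_comm (a := k)]
  rfl

lemma combine {V W ι κ : Type*} [Fintype V] [DecidableEq V] [Fintype ι] [DecidableEq ι]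
    [Fintype W] [DecidableEq W] [Fintype κ] [DecidableEq κ]
    (f : V → ι) (hf : Function.Surjective f) (g : W → κ) (hg : Function.Surjective g)
    (h : (pMat f).charpoly = (pMat g).charpoly) :
    ∃ e : V ≃ W, ∀ v w, f v = f w ↔ g (e v) = g (e w) := by
  have hc : Fintype.card V = Fintype.card W := by
    rw [← charpoly_natDegree_eq_dim (pMat f), h, charpoly_natDegree_eq_dim]
  have hR : rPoly f = rPoly g := by
    apply recover (Fintype.card V) _ _ (rPoly_natDegree f hf).le
      ((rPoly_natDegree g hg).trans hc.symm).le
    rw [← pMat_charpoly f hf, h, pMat_charpoly g hg, hc]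
  have hcount : ∀ k, Nonempty ({i // fibCard f i = k} ≃ {j // fibCard g j = k}) := by
    intro k
    rcases eq_or_ne k 0 with rfl | hk
    · have h1 : IsEmpty {i // fibCard f i = 0} := ⟨fun ⟨i, hi⟩ => by
        obtain ⟨v, hv⟩ := hf i
        exact (Fintype.card_eq_zero_iff.1 hi).false ⟨v, hv⟩⟩
      have h2 : IsEmpty {i // fibCard g i = 0} := ⟨fun ⟨i, hi⟩ => by
        obtain ⟨v, hv⟩ := hg i
        exact (Fintype.card_eq_zero_iff.1 hi).false ⟨v, hv⟩⟩
      exact ⟨Equiv.equivOfIsEmpty _ _⟩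
    · rw [← Fintype.card_eq, ← rPoly_roots f k hk, hR, rPoly_roots g k hk]
  let σ : ι ≃ κ := Equiv.ofFiberEquiv (f := fibCard f) (g := fibCard g) fun k => (hcount k).some
  have hσ : ∀ i, fibCard g (σ i) = fibCard f i := fun i => Equiv.ofFiberEquiv_map _ i
  have hfib : ∀ j, Nonempty ({v // σ (f v) = j} ≃ {w // g w = j}) := by
    intro j
    rw [← Fintype.card_eq]
    have h1 := hσ (σ.symm j)
    rw [Equiv.apply_symm_apply] at h1
    rw [fibCard, fibCard] at h1
    rw [h1]
    apply Fintype.card_congr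
    exact Equiv.subtypeEquivRight fun v => by rw [Equiv.eq_symm_apply]
  let e : V ≃ W := Equiv.ofFiberEquiv (f := fun v => σ (f v)) (g := g) fun k => (hfib k).some
  have he : ∀ v, g (e v) = σ (f v) := fun v => Equiv.ofFiberEquiv_map _ v
  exact ⟨e, fun v w => by rw [he, he, σ.apply_eq_iff_eq]⟩

lemma dist_multi {V ι : Type*} [Fintype V] [DecidableEq V] [DecidableEq ι]
    (f : V → ι) (G : SimpleGraph V) (hG : G.Connected) (h : ∀ v w, G.Adj v w ↔ f v ≠ f w) :
    distMatrix G + Matrix.scalar V 2 = pMat f := by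
  ext v w
  by_cases hvw : v = w
  · subst hvw; simp [distMatrix, pMat]; norm_num
  · by_cases hf : f v = f w
    · have : Nontrivial V := ⟨v, w, hvw⟩
      obtain ⟨u, hu⟩ := hG.preconnected.exists_adj_of_nontrivial v
      have hu' : G.Adj u w := by rw [h] at hu ⊢; rw [← hf]; exact hu.symm
      have h2 : G.dist v w ≤ 2 := SimpleGraph.dist_le (Walk.cons hu (Walk.cons hu' Walk.nil))
      have h0 : G.dist v w ≠ 0 := fun h0 => hvw ((hG.dist_eq_zero_iff).1 h0)
      have h1 : G.dist v w ≠ 1 := fun h1 => by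
        rw [SimpleGraph.dist_eq_one_iff_adj, h] at h1; exact h1 hf
      have : G.dist v w = 2 := by omega
      simp [distMatrix, pMat, hvw, hf, this]; norm_num
    · have : G.dist v w = 1 := by rw [SimpleGraph.dist_eq_one_iff_adj, h]; exact hf
      simp [distMatrix, pMat, hvw, hf, this]

open Polynomial in
lemma shift_charpoly {V : Type*} [Fintype V] [DecidableEq V] (G : SimpleGraph V) :
    (distMatrix G + Matrix.scalar V 2).charpoly =
      ((distSpec G).map fun r => (X - C (r + 2))).prod := by
  apply Polynomial.funext
  intro x
  have h : Matrix.scalar V x - (distMatrix G + Matrix.scalar V 2) =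
      Matrix.scalar V (x - 2) - distMatrix G := by
    rw [map_sub]; abel
  rw [Matrix.eval_charpoly, h, ← Matrix.eval_charpoly, (distMatrix_isHermitian G).charpoly_eq,
    distSpec, Multiset.map_map, eval_prod]
  change _ = eval x (∏ i, _)
  rw [eval_prod]
  apply Finset.prod_congr rfl
  intro i _
  simp
  ring

lemma psd_of {V W : Type*} [Fintype V] [DecidableEq V] [Fintype W] [DecidableEq W]
    (A : Matrix V V ℝ) (B : Matrix W W ℝ) (hA : A.IsHermitian) (hB : B.PosSemidef)
    (h : A.charpoly = B.charpoly) : A.PosSemidef := by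
  rw [hA.posSemidef_iff_eigenvalues_nonneg]
  intro i
  have h1 : hA.eigenvalues i ∈ A.charpoly.roots := by
    rw [hA.roots_charpoly_eq_eigenvalues]
    exact Multiset.mem_map.2 ⟨i, Finset.mem_univ_val _, rfl⟩
  rw [h, hB.1.roots_charpoly_eq_eigenvalues] at h1
  obtain ⟨j, _, hj⟩ := Multiset.mem_map.1 h1
  have := hB.eigenvalues_nonneg j
  simp only [Function.comp_apply, RCLike.ofReal_real_eq_id, id] at hj
  rw [← hj]
  exact this

lemma quad_nonneg {V : Type*} [Fintype V] [DecidableEq V] (A : Matrix V V ℝ)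
    (hA : A.PosSemidef) (x y z : V) (p q r : ℝ) :
    0 ≤ p * (p * A x x + q * A x y + r * A x z) + q * (p * A y x + q * A y y + r * A y z)
      + r * (p * A z x + q * A z y + r * A z z) := by
  have h := hA.dotProduct_mulVec_nonneg (p • Pi.single x 1 + q • Pi.single y 1 + r • Pi.single z 1)
  simp [mulVec_add, mulVec_smul, add_dotProduct, dotProduct_add] at h
  linarith

lemma multi_of_psd {V : Type*} [Fintype V] [DecidableEq V] (G : SimpleGraph V) (hG : G.Connected)
    (h : (distMatrix G + Matrix.scalar V 2).PosSemidef) (x y z : V)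
    (hxy : ¬ G.Adj x y) (hyz : ¬ G.Adj y z) : ¬ G.Adj x z := by
  intro hxz
  by_cases exy : x = y
  · subst exy; exact hyz hxz
  by_cases eyz : y = z
  · subst eyz; exact hxy hxz
  have exz : x ≠ z := hxz.ne
  have d2 : ∀ u v, u ≠ v → ¬ G.Adj u v → G.dist u v = 2 := by
    intro u v huv hn
    have h0 : G.dist u v ≠ 0 := fun h0 => huv ((hG.dist_eq_zero_iff).1 h0)
    have h1 : G.dist u v ≠ 1 := fun h1 => hn (SimpleGraph.dist_eq_one_iff_adj.1 h1)
    have hq := quad_nonneg _ h u v v 1 (-1) 0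
    simp [distMatrix, huv, huv.symm, SimpleGraph.dist_comm (u := v) (v := u)] at hq
    omega
  have hq := quad_nonneg _ h x y z 1 (-2) 1
  have e1 := d2 x y exy hxy
  have e2 := d2 y z eyz hyz
  have e3 : G.dist x z = 1 := SimpleGraph.dist_eq_one_iff_adj.2 hxz
  simp [distMatrix, exy, eyz, exz, Ne.symm exy, Ne.symm eyz, exz.symm,
    SimpleGraph.dist_comm (u := y) (v := x), SimpleGraph.dist_comm (u := z) (v := x),
    SimpleGraph.dist_comm (u := z) (v := y), e1, e2, e3] at hq
  norm_num at hq

theorem dcube_stmt6 {W : Type*} [Fintype W] [DecidableEq W] (s : ℕ) (a : Fin s → ℕ)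
    (ha : ∀ i, 0 < a i)
    (hG : (completeMultipartiteGraph fun i : Fin s => Fin (a i)).Connected)
    (Ω : SimpleGraph W) (hΩ : Ω.Connected)
    (hspec : distSpec Ω = distSpec (completeMultipartiteGraph fun i : Fin s => Fin (a i))) :
    Nonempty (Ω ≃g completeMultipartiteGraph fun i : Fin s => Fin (a i)) := by
  classical
  have hK := dist_multi (Sigma.fst : (Σ i : Fin s, Fin (a i)) → Fin s) _ hG
    (fun v w => by simp [completeMultipartiteGraph])
  have hch := shift_charpoly Ω
  rw [hspec, ← shift_charpoly, hK] at hch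
  have hherm : (distMatrix Ω + Matrix.scalar W 2).IsHermitian := by
    apply (distMatrix_isHermitian Ω).add
    ext i j
    by_cases h : i = j
    · subst h; simp
    · simp [h, Ne.symm h]
  have hpsd := psd_of _ _ hherm (pMat_posSemidef _) hch
  let S : Setoid W := 
    { r := fun x y => ¬ Ω.Adj x y
      iseqv := ⟨fun x => Ω.irrefl, fun h h' => h h'.symm,
        fun {x y z} h1 h2 => multi_of_psd Ω hΩ hpsd x y z h1 h2⟩ }
  let f : W → Quotient S := Quotient.mk S
  have hadj : ∀ v w, Ω.Adj v w ↔ f v ≠ f w := by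
    intro v w
    have : f v = f w ↔ ¬ Ω.Adj v w := Quotient.eq (r := S)
    rw [Ne, this, not_not]
  have hΩm := dist_multi f Ω hΩ hadj
  rw [hΩm] at hch
  obtain ⟨e, he⟩ := combine f Quotient.mk_surjective _
    (fun i => ⟨⟨i, ⟨0, ha i⟩⟩, rfl⟩) hch
  refine ⟨⟨e, ?_⟩⟩
  intro v w
  rw [hadj, Ne, he]
  simp [completeMultipartiteGraph]
end

section
/- Let Γ be a connected graph with exactly three distinct distance eigenvalues δ_0 > δ_1 > δ_2. If δ_0 is not an integer, then Γ is a complete bipartite graph. -/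
open SimpleGraph Matrix Finset

section helpers
open Polynomial

lemma splits_of_prod {V : Type*} [Fintype V] (lam : V → ℝ) (P : ℤ[X])
    (hP : P.map (Int.castRingHom ℝ) = ∏ i, (X - C (lam i))) (g : ℚ[X])
    (hg : g ∣ P.map (Int.castRingHom ℚ)) : (g.map (algebraMap ℚ ℝ)).Splits := by
  have h1 : g.map (algebraMap ℚ ℝ) ∣ ∏ i, (X - C (lam i)) := by
    rw [← hP]
    have := Polynomial.map_dvd (algebraMap ℚ ℝ) hg
    rw [Polynomial.map_map] at this
    convert this using 2
    ext; simp
  refine Polynomial.Splits.of_dvd ?_ ?_ h1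
  · exact Polynomial.Splits.prod (fun i _ => Polynomial.Splits.X_sub_C _)
  · exact Finset.prod_ne_zero_iff.mpr (fun i _ => Polynomial.X_sub_C_ne_zero _)

lemma aeval_mapQ (P : ℤ[X]) (x : ℝ) :
    aeval x (P.map (Int.castRingHom ℚ)) = (P.map (Int.castRingHom ℝ)).eval x := by
    rw [aeval_def, eval₂_eq_eval_map, Polynomial.map_map]
    congr 2

lemma minpoly_dvd_P {V : Type*} [Fintype V] (lam : V → ℝ) (P : ℤ[X])
    (hP : P.map (Int.castRingHom ℝ) = ∏ i, (X - C (lam i))) (i : V) :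
    minpoly ℚ (lam i) ∣ P.map (Int.castRingHom ℚ) := by
  apply minpoly.dvd
  rw [aeval_mapQ, hP, eval_prod]
  exact Finset.prod_eq_zero (Finset.mem_univ i) (by simp)

lemma int_of_only_root {V : Type*} [Fintype V] (lam : V → ℝ) (P : ℤ[X]) (hm : P.Monic)
    (hP : P.map (Int.castRingHom ℝ) = ∏ i, (X - C (lam i))) (i : V)
    (h : ∀ j, aeval (lam j) (minpoly ℚ (lam i)) = 0 → lam j = lam i) :
    ∃ z : ℤ, (z : ℝ) = lam i := by
  have hint : IsIntegral ℤ (lam i) := by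
    refine ⟨P, hm, ?_⟩
    rw [eval₂_eq_eval_map]
    have : P.map (algebraMap ℤ ℝ) = P.map (Int.castRingHom ℝ) := rfl
    rw [this, hP, eval_prod]
    exact Finset.prod_eq_zero (Finset.mem_univ i) (by simp)
  have hintQ : IsIntegral ℚ (lam i) := hint.tower_top
  have hd := minpoly_dvd_P lam P hP i
  have hs := splits_of_prod lam P hP _ hd
  have hsep : (minpoly ℚ (lam i)).Separable := (minpoly.irreducible hintQ).separable
  have hc := card_rootSet_eq_natDegree hsep hs
  have hsub : (minpoly ℚ (lam i)).rootSet ℝ ⊆ {lam i} := by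
    intro x hx
    have hx0 : aeval x (minpoly ℚ (lam i)) = 0 := aeval_eq_zero_of_mem_rootSet hx
    have : aeval x (P.map (Int.castRingHom ℚ)) = 0 := by
      obtain ⟨q, hq⟩ := hd
      rw [hq, map_mul, hx0, zero_mul]
    rw [aeval_mapQ, hP, eval_prod, Finset.prod_eq_zero_iff] at this
    obtain ⟨j, -, hj⟩ := this
    have hxj : x = lam j := by simpa [sub_eq_zero] using hj
    subst hxj
    exact h j hx0
  have hle : (minpoly ℚ (lam i)).natDegree ≤ 1 := by
    rw [← hc, ← Nat.card_eq_fintype_card]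
    have := Set.ncard_le_ncard hsub (Set.finite_singleton _)
    rw [Set.ncard_singleton] at this
    exact this
  have hpos := minpoly.natDegree_pos hintQ
  have h1 : (minpoly ℚ (lam i)).natDegree = 1 := by omega
  rw [minpoly.natDegree_eq_one_iff] at h1
  obtain ⟨q, hq⟩ := h1
  rw [← hq] at hint
  have hqi : IsIntegral ℤ q := by
    rwa [isIntegral_algebraMap_iff (algebraMap ℚ ℝ).injective] at hint
  obtain ⟨z, hz⟩ := IsIntegrallyClosed.isIntegral_iff.mp hqi
  refine ⟨z, ?_⟩
  rw [← hq, ← hz]; simp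

lemma deriv_ne_iff {V : Type*} [Fintype V] (lam : V → ℝ) (P : ℤ[X])
    (hP : P.map (Int.castRingHom ℝ) = ∏ i, (X - C (lam i))) (i : V) :
    aeval (lam i) (derivative (P.map (Int.castRingHom ℚ))) ≠ 0 ↔
      ∀ j, lam j = lam i → j = i := by
  classical
  rw [derivative_map, aeval_mapQ, ← derivative_map, hP, derivative_prod_finset, eval_finsetSum]
  have : ∑ k, eval (lam i) ((∏ j ∈ univ.erase k, (X - C (lam j))) * derivative (X - C (lam k)))
      = ∏ j ∈ univ.erase i, (lam i - lam j) := by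
    rw [Finset.sum_eq_single i]
    · simp [eval_prod]
    · intro k _ hk
      rw [eval_mul, eval_prod, Finset.prod_eq_zero (i := i)] <;> simp [Ne.symm hk]
    · simp
  rw [this, Finset.prod_ne_zero_iff]
  constructor
  · intro h j hj
    by_contra hne
    exact h j (by simp [hne]) (by rw [hj, sub_self])
  · intro h j hj h0
    exact (Finset.mem_erase.mp hj).1 (h j (by linarith))

lemma simple_conj {V : Type*} [Fintype V] (lam : V → ℝ) (P : ℤ[X]) (hm : P.Monic)
    (hP : P.map (Int.castRingHom ℝ) = ∏ i, (X - C (lam i))) (i k : V)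
    (hi : ∀ j, lam j = lam i → j = i)
    (hk : aeval (lam k) (minpoly ℚ (lam i)) = 0) : ∀ j, lam j = lam k → j = k := by
  rw [← deriv_ne_iff lam P hP] at hi ⊢
  intro h0
  apply hi
  have hintQ : IsIntegral ℚ (lam i) := by
    refine ⟨P.map (Int.castRingHom ℚ), hm.map _, ?_⟩
    rw [← aeval_def, aeval_mapQ, hP, eval_prod]
    exact Finset.prod_eq_zero (Finset.mem_univ i) (by simp)
  have hmin : minpoly ℚ (lam i) = minpoly ℚ (lam k) :=
    minpoly.eq_of_irreducible_of_monic (minpoly.irreducible hintQ) hk (minpoly.monic hintQ)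
  have := minpoly.dvd ℚ _ h0
  rw [← hmin] at this
  obtain ⟨q, hq⟩ := this
  rw [hq, map_mul, minpoly.aeval, zero_mul]

end helpers

lemma shift_decomp {V : Type*} [Fintype V] [DecidableEq V] {A : Matrix V V ℝ}
    (hA : A.IsHermitian) (c : ℝ) :
    c • (1 : Matrix V V ℝ) - A = (hA.eigenvectorUnitary : Matrix V V ℝ) *
      diagonal (fun i => c - hA.eigenvalues i) * (hA.eigenvectorUnitary : Matrix V V ℝ)ᴴ := by
  have h1 := hA.spectral_theorem
  rw [Unitary.conjStarAlgAut_apply] at h1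
  have h2 : (hA.eigenvectorUnitary : Matrix V V ℝ) * (hA.eigenvectorUnitary : Matrix V V ℝ)ᴴ = 1 :=
    Unitary.coe_mul_star_self hA.eigenvectorUnitary
  have h3 : diagonal (fun i => c - hA.eigenvalues i) =
      c • (1 : Matrix V V ℝ) - diagonal hA.eigenvalues := by
    ext i j
    by_cases h : i = j
    · subst h; simp
    · simp [h]
  rw [h3, Matrix.mul_sub, Matrix.sub_mul, Matrix.mul_smul, Matrix.smul_mul, mul_one, h2]
  congr 1

lemma posSemidef_shift {V : Type*} [Fintype V] [DecidableEq V] {A : Matrix V V ℝ}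
    (hA : A.IsHermitian) (c : ℝ) (h : ∀ i, hA.eigenvalues i ≤ c) :
    (c • (1 : Matrix V V ℝ) - A).PosSemidef := by
  rw [shift_decomp hA c]
  apply PosSemidef.mul_mul_conjTranspose_same
  rw [posSemidef_diagonal_iff]
  intro i; linarith [h i]

lemma rank_shift_le {V : Type*} [Fintype V] [DecidableEq V] {A : Matrix V V ℝ}
    (hA : A.IsHermitian) (c : ℝ) (i j : V) (h : ∀ k, k ≠ i → k ≠ j → hA.eigenvalues k = c) :
    (c • (1 : Matrix V V ℝ) - A).rank ≤ 2 := by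
  rw [shift_decomp hA c]
  refine (rank_mul_le_left _ _).trans ((rank_mul_le_right _ _).trans ?_)
  rw [rank_diagonal, Fintype.card_subtype]
  refine (Finset.card_le_card (t := {i, j}) ?_).trans Finset.card_le_two
  intro k hk
  simp only [Finset.mem_filter, Finset.mem_univ, true_and] at hk
  by_contra hne
  simp only [Finset.mem_insert, Finset.mem_singleton, not_or] at hne
  exact hk (by rw [h k hne.1 hne.2, sub_self])

lemma det_minor {V : Type*} [Fintype V] {A : Matrix V V ℝ} (h : A.rank ≤ 2) (f : Fin 3 → V) :
    (A.submatrix f f).det = 0 := by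
  by_contra h0
  have h1 := rank_submatrix_le A f f
  have h2 := rank_of_isUnit (A.submatrix f f) ((Matrix.isUnit_iff_isUnit_det _).mpr (isUnit_iff_ne_zero.mpr h0))
  rw [h2] at h1
  simp at h1
  omega

lemma pf_zero {V : Type*} [Fintype V] [DecidableEq V] {A : Matrix V V ℝ}
    (hA : A.IsHermitian) (c : ℝ) (h : ∀ i, hA.eigenvalues i ≤ c)
    (hnn : ∀ i j, 0 ≤ A i j) (hpos : ∀ i j, i ≠ j → 0 < A i j) (v : V → ℝ)
    (hv : A *ᵥ v = c • v) (x : V) (hx : v x = 0) : v = 0 := by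
  have hps := posSemidef_shift hA c h
  set w : V → ℝ := fun i => |v i| with hw
  have hq : star w ⬝ᵥ (c • (1 : Matrix V V ℝ) - A) *ᵥ w = 0 := by
    apply le_antisymm _ (hps.dotProduct_mulVec_nonneg w)
    have e1 : star v ⬝ᵥ (c • (1 : Matrix V V ℝ) - A) *ᵥ v = 0 := by
      rw [Matrix.sub_mulVec, Matrix.smul_mulVec, one_mulVec, hv, sub_self, dotProduct_zero]
    rw [← e1]
    simp only [Matrix.sub_mulVec, Matrix.smul_mulVec, one_mulVec, dotProduct_sub, dotProduct_smul,
      star_trivial]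
    have e2 : w ⬝ᵥ w = v ⬝ᵥ v := by
      simp [dotProduct, hw]
    have e3 : v ⬝ᵥ A *ᵥ v ≤ w ⬝ᵥ A *ᵥ w := by
      simp only [dotProduct, mulVec, Finset.mul_sum]
      refine Finset.sum_le_sum fun i _ => Finset.sum_le_sum fun j _ => ?_
      calc v i * (A i j * v j) ≤ |v i * (A i j * v j)| := le_abs_self _
        _ = w i * (A i j * w j) := by
          rw [abs_mul, abs_mul, abs_of_nonneg (hnn i j)]
    rw [e2]; linarith
  rw [hps.dotProduct_mulVec_zero_iff] at hq
  have hxx := congrFun hq x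
  simp only [Matrix.sub_mulVec, Matrix.smul_mulVec, one_mulVec, Pi.sub_apply, Pi.smul_apply,
    Pi.zero_apply, hw, hx, abs_zero, smul_zero, zero_sub, neg_eq_zero] at hxx
  simp only [mulVec, dotProduct] at hxx
  rw [Finset.sum_eq_zero_iff_of_nonneg (fun i _ => mul_nonneg (hnn x i) (abs_nonneg _))] at hxx
  funext i
  by_cases hi : x = i
  · rw [← hi, hx]; rfl
  · have := hxx i (Finset.mem_univ i)
    rcases mul_eq_zero.mp this with h1 | h1
    · exact absurd h1 (hpos x i hi).ne'
    · exact abs_eq_zero.mp h1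

lemma pf_simple {V : Type*} [Fintype V] [DecidableEq V] {A : Matrix V V ℝ}
    (hA : A.IsHermitian) (c : ℝ) (h : ∀ i, hA.eigenvalues i ≤ c)
    (hnn : ∀ i j, 0 ≤ A i j) (hpos : ∀ i j, i ≠ j → 0 < A i j) (i j : V)
    (hi : hA.eigenvalues i = c) (hj : hA.eigenvalues j = c) : i = j := by
  by_contra hij
  have vi := hA.mulVec_eigenvectorBasis i
  have vj := hA.mulVec_eigenvectorBasis j
  rw [hi] at vi
  rw [hj] at vj
  set a := hA.eigenvectorBasis i with ha
  set b := hA.eigenvectorBasis j with hb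
  have hw := pf_zero hA c h hnn hpos ((b i) • ⇑a - (a i) • ⇑b)
    (by rw [Matrix.mulVec_sub, Matrix.mulVec_smul, Matrix.mulVec_smul, vi, vj, smul_sub,
          smul_comm c, smul_comm c]) i (by simp [mul_comm])
  have haa : inner ℝ a a = (1 : ℝ) := by
    rw [real_inner_self_eq_norm_sq, ha, hA.eigenvectorBasis.norm_eq_one]; simp
  have hab : inner ℝ a b = (0 : ℝ) := hA.eigenvectorBasis.inner_eq_zero hij
  have hw' : (b i) • a - (a i) • b = 0 := by
    ext k; exact congrFun hw k
  have h1 : b i = 0 := by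
    have := congrArg (fun z => inner ℝ a z) hw'
    simp only [inner_sub_right, inner_smul_right, haa, hab, inner_zero_right] at this
    linarith
  have hb0 := pf_zero hA c h hnn hpos (⇑b) vj i h1
  have hb1 := hA.eigenvectorBasis.norm_eq_one j
  rw [← hb] at hb1
  have : b = 0 := by ext k; exact congrFun hb0 k
  rw [this] at hb1
  simp at hb1

lemma complete_eig {V : Type*} [Fintype V] [DecidableEq V] {A : Matrix V V ℝ}
    (hA : A.IsHermitian) (h : ∀ i j, A i j = if i = j then 0 else 1) (i : V) :
    hA.eigenvalues i = -1 ∨ hA.eigenvalues i = Fintype.card V - 1 := by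
  have vi := hA.mulVec_eigenvectorBasis i
  set a := hA.eigenvectorBasis i with ha
  set l := hA.eigenvalues i
  have key : ∀ x, ∑ y, a y = (l + 1) * a x := by
    intro x
    have := congrFun vi x
    simp only [mulVec, dotProduct, h, Pi.smul_apply, smul_eq_mul] at this
    have e : ∀ y, (if x = y then (0:ℝ) else 1) * a y = a y - if x = y then a y else 0 := by
      intro y; split_ifs <;> simp
    simp only [e, Finset.sum_sub_distrib, Finset.sum_ite_eq, Finset.mem_univ, if_true] at this
    linarith
  by_cases h1 : l = -1
  · exact Or.inl h1
  right
  have hl : l + 1 ≠ 0 := fun h => h1 (by linarith)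
  have hs : (Fintype.card V : ℝ) * ∑ y, a y = (l + 1) * ∑ y, a y := by
    have e : ∑ x : V, ∑ y, a y = ∑ x, (l + 1) * a x := Finset.sum_congr rfl (fun x _ => key x)
    rw [← Finset.mul_sum] at e
    simpa using e
  have hne : ∑ y, a y ≠ 0 := by
    intro h0
    have hz : a = 0 := by
      ext x
      have := key x
      rw [h0] at this
      rcases mul_eq_zero.mp this.symm with h2 | h2
      · exact absurd h2 hl
      · exact h2
    have hb1 := hA.eigenvectorBasis.norm_eq_one i
    rw [← ha, hz] at hb1
    simp at hb1
  have := mul_right_cancel₀ hne hs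
  linarith

lemma bip_of_key {V : Type*} [Fintype V] [DecidableEq V] (G : SimpleGraph V) (x y : V)
    (hxy : G.Adj x y) (K : ∀ a b c, G.Adj a b → (G.Adj a c ↔ ¬ G.Adj b c)) :
    ∃ a b : ℕ, 0 < a ∧ 0 < b ∧
      Nonempty (G ≃g completeBipartiteGraph (Fin a) (Fin b)) := by
  classical
  have hc : ∀ u v, G.Adj u v ↔ ¬ (G.Adj x u ↔ G.Adj x v) := by
    intro u v
    constructor
    · intro h
      have := K u v x h
      rw [G.adj_comm u x, G.adj_comm v x] at this
      tauto
    · intro h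
      by_cases hu : G.Adj x u
      · have := K x u v hu
        tauto
      · have hv : G.Adj x v := by tauto
        have := K x v u hv
        rw [G.adj_comm v u] at this
        tauto
  let e := Equiv.sumCompl (fun u => G.Adj x u)
  let f := Equiv.sumCongr (Fintype.equivFin {u // G.Adj x u}) (Fintype.equivFin {u // ¬ G.Adj x u})
  refine ⟨_, _, Fintype.card_pos_iff.mpr ⟨⟨y, hxy⟩⟩, Fintype.card_pos_iff.mpr ⟨⟨x, by simp⟩⟩,
    ⟨RelIso.symm ⟨f.symm.trans e, ?_⟩⟩⟩
  intro p q
  rcases p with p | p <;> rcases q with q | q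
  all_goals
    simp only [e, f, Equiv.trans_apply, Equiv.sumCongr_symm, Equiv.sumCongr_apply, Sum.map_inl,
      Sum.map_inr, Equiv.sumCompl_apply_inl, Equiv.sumCompl_apply_inr]
    rw [hc]
    first
    | have h1 := ((Fintype.equivFin {u // G.Adj x u}).symm p).2
    | have h1 := ((Fintype.equivFin {u // ¬ G.Adj x u}).symm p).2
    first
    | have h2 := ((Fintype.equivFin {u // G.Adj x u}).symm q).2
    | have h2 := ((Fintype.equivFin {u // ¬ G.Adj x u}).symm q).2
    simp [h1, h2]

lemma key_n3 {V : Type*} [Fintype V] [DecidableEq V] (G : SimpleGraph V) (p q r : V)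
    (hpq : G.Adj p q) (hqr : G.Adj q r) (hpr : ¬ G.Adj p r) (hne : p ≠ r)
    (hcard : Fintype.card V ≤ 3) : ∀ a b c, G.Adj a b → (G.Adj a c ↔ ¬ G.Adj b c) := by
  have hu : ({p, q, r} : Finset V) = univ := by
    apply Finset.eq_univ_of_card
    apply le_antisymm (Finset.card_le_univ _)
    rw [Finset.card_eq_three.mpr ⟨p, q, r, hpq.ne, hne, hqr.ne, rfl⟩]
    exact hcard
  have hm : ∀ a, a = p ∨ a = q ∨ a = r := by
    intro a
    have := Finset.mem_univ a
    rw [← hu] at this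
    simpa using this
  have hqp := hpq.symm
  have hrq := hqr.symm
  have hrp : ¬ G.Adj r p := fun h => hpr h.symm
  intro a b c
  rcases hm a with rfl | rfl | rfl <;> rcases hm b with rfl | rfl | rfl <;>
    rcases hm c with rfl | rfl | rfl <;> simp [*]

lemma int_cubic (t : ℤ) (h : t ^ 3 - 6 * t + 4 = 0) : t = 2 := by
  have h1 : (t - 2) * (t ^ 2 + 2 * t - 2) = 0 := by ring_nf; linarith
  rcases mul_eq_zero.mp h1 with h2 | h2
  · linarith
  · exfalso
    have h3 : (t + 1) * (t + 1) = 3 := by linarith [sq t, show (t+1)*(t+1) = t^2+2*t+1 by ring]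
    have h4 : t + 1 ≤ 2 := by nlinarith
    have h5 : -2 ≤ t + 1 := by nlinarith
    have : t + 1 = -2 ∨ t + 1 = -1 ∨ t + 1 = 0 ∨ t + 1 = 1 ∨ t + 1 = 2 := by omega
    rcases this with h | h | h | h | h <;> rw [h] at h3 <;> norm_num at h3

lemma minor_eq {V : Type*} [Fintype V] [DecidableEq V] (G : SimpleGraph V) (z : ℤ)
    (hr : ((z : ℝ) • (1 : Matrix V V ℝ) - distMatrix G).rank ≤ 2) (a b c : V)
    (hab : a ≠ b) (hac : a ≠ c) (hbc : b ≠ c) :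
    (-z) ^ 3 + 2 * (G.dist a b : ℤ) * G.dist a c * G.dist b c
      + z * ((G.dist a b : ℤ) ^ 2 + (G.dist a c : ℤ) ^ 2 + (G.dist b c : ℤ) ^ 2) = 0 := by
  have := det_minor hr ![a, b, c]
  rw [Matrix.det_fin_three] at this
  simp [distMatrix, Matrix.one_apply, hab, hac, hbc, hab.symm, hac.symm, hbc.symm,
    G.dist_comm (u := b) (v := a), G.dist_comm (u := c) (v := a),
    G.dist_comm (u := c) (v := b)] at this
  have h2 : (-(z : ℝ)) ^ 3 + 2 * (G.dist a b : ℝ) * G.dist a c * G.dist b c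
      + z * ((G.dist a b : ℝ) ^ 2 + (G.dist a c : ℝ) ^ 2 + (G.dist b c : ℝ) ^ 2) = 0 := by
    linear_combination -this
  exact_mod_cast h2

lemma key_rank {V : Type*} [Fintype V] [DecidableEq V] (G : SimpleGraph V) (hconn : G.Connected)
    (p q r : V)
    (hpq : G.Adj p q) (hqr : G.Adj q r) (hpr : ¬ G.Adj p r) (hne : p ≠ r) (z : ℤ)
    (hr : ((z : ℝ) • (1 : Matrix V V ℝ) - distMatrix G).rank ≤ 2) :
    ∀ a b c, G.Adj a b → (G.Adj a c ↔ ¬ G.Adj b c) := by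
  have hz : z = -2 := by
    have h1 : G.dist p q = 1 := dist_eq_one_iff_adj.mpr hpq
    have h2 : G.dist q r = 1 := dist_eq_one_iff_adj.mpr hqr
    have h3 : G.dist p r = 2 := by
      have := hconn.dist_triangle (u := p) (v := q) (w := r)
      have := (hconn p r).one_lt_dist_of_ne_of_not_adj hne hpr
      omega
    have := minor_eq G z hr p q r hpq.ne hne hqr.ne
    rw [h1, h2, h3] at this
    have := int_cubic (-z) (by push_cast at this; linarith)
    linarith
  subst hz
  intro a b c hab
  by_cases hac : a = c
  · subst hac; simp [hab.symm]
  by_cases hbc : b = c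
  · subst hbc; simp [hab]
  have hm := minor_eq G (-2) hr a b c hab.ne hac hbc
  rw [dist_eq_one_iff_adj.mpr hab] at hm
  constructor
  · intro h1 h2
    rw [dist_eq_one_iff_adj.mpr h1, dist_eq_one_iff_adj.mpr h2] at hm
    norm_num at hm
  · intro h2
    by_contra h1
    have e1 : (2 : ℤ) ≤ G.dist a c := by
      exact_mod_cast (hconn a c).one_lt_dist_of_ne_of_not_adj hac h1
    have e2 : (2 : ℤ) ≤ G.dist b c := by
      exact_mod_cast (hconn b c).one_lt_dist_of_ne_of_not_adj hbc h2
    push_cast at hm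
    nlinarith [sq_nonneg ((G.dist a c : ℤ) - G.dist b c), mul_nonneg (sub_nonneg.mpr e1) (sub_nonneg.mpr e2)]

theorem dcube_stmt10 {V : Type*} [Fintype V] [DecidableEq V] (G : SimpleGraph V)
    (hconn : G.Connected) (δ0 δ1 δ2 : ℝ) (h21 : δ2 < δ1) (h10 : δ1 < δ0)
    (hspec : (distSpec G).toFinset = {δ0, δ1, δ2})
    (hirr : ∀ z : ℤ, (z : ℝ) ≠ δ0) :
    ∃ a b : ℕ, 0 < a ∧ 0 < b ∧
      Nonempty (G ≃g completeBipartiteGraph (Fin a) (Fin b)) := by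
  have hA := distMatrix_isHermitian G
  set lam := hA.eigenvalues with hlam
  have hmem : ∀ x, (∃ i, lam i = x) ↔ (x = δ0 ∨ x = δ1 ∨ x = δ2) := by
    intro x
    have : x ∈ (distSpec G).toFinset ↔ x ∈ ({δ0, δ1, δ2} : Finset ℝ) := by rw [hspec]
    simpa [distSpec] using this
  obtain ⟨i0, hi0⟩ := (hmem δ0).mpr (by simp)
  obtain ⟨i1, hi1⟩ := (hmem δ1).mpr (by simp)
  obtain ⟨i2, hi2⟩ := (hmem δ2).mpr (by simp)
  have hcases : ∀ i, lam i = δ0 ∨ lam i = δ1 ∨ lam i = δ2 := fun i => (hmem _).mp ⟨i, rfl⟩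
  -- a path of length two
  obtain ⟨p, q, r, hpq, hqr, hpr, hne⟩ :
      ∃ p q r, G.Adj p q ∧ G.Adj q r ∧ ¬ G.Adj p r ∧ p ≠ r := by
    by_cases hcomp : ∀ u v, u ≠ v → G.Adj u v
    · exfalso
      have hc := complete_eig hA (fun i j => by
        by_cases h : i = j
        · subst h; simp [distMatrix]
        · simp [distMatrix, h, dist_eq_one_iff_adj.mpr (hcomp i j h)])
      have a0 := hc i0
      have a1 := hc i1
      have a2 := hc i2
      rw [← hlam, hi0] at a0
      rw [← hlam, hi1] at a1
      rw [← hlam, hi2] at a2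
      rcases a0 with a0 | a0 <;> rcases a1 with a1 | a1 <;> rcases a2 with a2 | a2 <;> linarith
    · push Not at hcomp
      obtain ⟨u, v, huv, hnadj⟩ := hcomp
      obtain ⟨w, hw⟩ := hconn.exists_walk_length_eq_dist u v
      exact Walk.exists_adj_adj_not_adj_ne hw ((hconn u v).one_lt_dist_of_ne_of_not_adj huv hnadj)
  have hs0 : ∀ j, lam j = lam i0 → j = i0 := by
    intro j hj
    refine pf_simple hA δ0 ?_ ?_ ?_ j i0 (hj.trans hi0) hi0
    · intro i
      rcases hcases i with h | h | h <;> rw [← hlam, h] <;> linarith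
    · intro i j; simp [distMatrix]
    · intro i j hij
      simpa [distMatrix] using hconn.pos_dist_of_ne hij
  let B : Matrix V V ℤ := Matrix.of fun x y => (G.dist x y : ℤ)
  have hm : B.charpoly.Monic := Matrix.charpoly_monic B
  have hP : B.charpoly.map (Int.castRingHom ℝ) = ∏ i, (Polynomial.X - Polynomial.C (lam i)) := by
    rw [← Matrix.charpoly_map]
    have : B.map (Int.castRingHom ℝ) = distMatrix G := by
      ext x y; simp [B, distMatrix]
    have h2 := hA.charpoly_eq
    simp only [RCLike.ofReal_real_eq_id, id] at h2
    rw [this]; exact h2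
  have hsc := fun k => simple_conj lam _ hm hP i0 k hs0
  apply bip_of_key G p q hpq
  -- one integer eigenvalue of multiplicity n-2
  have main : ∀ i j : V, (∀ k, lam k = lam i0 ∨ lam k = lam i ∨ lam k = lam j) →
      lam i ≠ lam j → lam j ≠ lam i0 →
      Polynomial.aeval (lam i) (minpoly ℚ (lam i0)) = 0 →
      Polynomial.aeval (lam j) (minpoly ℚ (lam i0)) ≠ 0 →
      ∀ a b c, G.Adj a b → (G.Adj a c ↔ ¬ G.Adj b c) := by
    intro i j hk hij hj0 hi hj
    have hint0 : IsIntegral ℚ (lam i0) := by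
      by_contra h
      rw [minpoly.eq_zero h] at hj
      simp at hj
    have hmin : minpoly ℚ (lam i0) = minpoly ℚ (lam i) :=
      minpoly.eq_of_irreducible_of_monic (minpoly.irreducible hint0) hi (minpoly.monic hint0)
    have hintj : IsIntegral ℚ (lam j) := by
      refine ⟨B.charpoly.map (Int.castRingHom ℚ), hm.map _, ?_⟩
      rw [← Polynomial.aeval_def, aeval_mapQ, hP, Polynomial.eval_prod]
      exact Finset.prod_eq_zero (Finset.mem_univ j) (by simp)
    have hcon : ∀ x : ℝ, Polynomial.aeval x (minpoly ℚ (lam j)) = 0 →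
        minpoly ℚ (lam j) = minpoly ℚ x := fun x hx =>
      minpoly.eq_of_irreducible_of_monic (minpoly.irreducible hintj) hx (minpoly.monic hintj)
    obtain ⟨z, hz⟩ := int_of_only_root lam _ hm hP j (by
      intro k hkj
      have hk' := hcon _ hkj
      rcases hk k with h | h | h
      · rw [h] at hk'
        exact absurd (by rw [← hk']; exact minpoly.aeval ℚ (lam j)) hj
      · rw [h, ← hmin] at hk'
        exact absurd (by rw [← hk']; exact minpoly.aeval ℚ (lam j)) hj
      · exact h)
    refine key_rank G hconn p q r hpq hqr hpr hne z ?_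
    apply rank_shift_le hA _ i0 i
    intro k hk0 hki
    rcases hk k with h | h | h
    · exact absurd (hs0 k h) hk0
    · exact absurd (hsc i hi k h) hki
    · rw [hz]; exact h
  by_cases c1 : Polynomial.aeval (lam i1) (minpoly ℚ (lam i0)) = 0 <;>
    by_cases c2 : Polynomial.aeval (lam i2) (minpoly ℚ (lam i0)) = 0
  · apply key_n3 G p q r hpq hqr hpr hne
    rw [← Finset.card_univ]
    refine (Finset.card_le_card (t := {i0, i1, i2}) ?_).trans Finset.card_le_three
    intro k _
    simp only [Finset.mem_insert, Finset.mem_singleton]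
    rcases hcases k with h | h | h
    · exact Or.inl (hs0 k (h.trans hi0.symm))
    · exact Or.inr (Or.inl (hsc i1 c1 k (h.trans hi1.symm)))
    · exact Or.inr (Or.inr (hsc i2 c2 k (h.trans hi2.symm)))
  · refine main i1 i2 ?_ ?_ ?_ c1 c2
    · rw [hi0, hi1, hi2]; exact hcases
    · rw [hi1, hi2]; exact h21.ne'
    · rw [hi0, hi2]; exact (h21.trans h10).ne
  · refine main i2 i1 ?_ ?_ ?_ c2 c1
    · rw [hi0, hi1, hi2]; intro k; have := hcases k; tauto
    · rw [hi1, hi2]; exact h21.ne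
    · rw [hi0, hi1]; exact h10.ne
  · exfalso
    obtain ⟨z, hz⟩ := int_of_only_root lam _ hm hP i0 (by
      intro k hk
      rcases hcases k with h | h | h
      · rw [h, hi0]
      · rw [h, ← hi1] at hk; exact absurd hk c1
      · rw [h, ← hi2] at hk; exact absurd hk c2)
    exact hirr z (hz.trans hi0)
end
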